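/- arXiv:2109.15062 — 3 statements merged into one kernel-verified Lean document; each statement's English description precedes it below -/
import Mathlib

section
/- Strengthened independence of a Pt-score (Lemma 1): let t be a {0,1}-valued treatment, y(0), y(1) potential outcomes, v a random variable, and for each t' ∈ {0,1} let P_{t'} be a measurable function of v. If y(t') ⫫ t | v holds for t' = 0,1 (exchangeability given v) and y(t') ⫫ v | P_{t'}(v) holds for t' = 0,1 (P is a Pt-score), then y(t') ⫫ (t, v) | P_{t'}(v) for t' = 0,1. -/
open MeasureTheory ProbabilityTheory

section CondIndep

variable {Ω : Type*} {m₁ m₂ m m' mΩ : MeasurableSpace Ω} {μ : Measure Ω}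

/-- The σ-algebra `m₁ ⊔ m₂` is generated by intersections of measurable sets. -/
lemma sup_eq_generateFrom_image2_inter (m₁ m₂ : MeasurableSpace Ω) :
    m₁ ⊔ m₂ = MeasurableSpace.generateFrom
      (Set.image2 (· ∩ ·) {s | MeasurableSet[m₁] s} {s | MeasurableSet[m₂] s}) := by
  apply le_antisymm
  · refine sup_le (fun s hs ↦ ?_) (fun s hs ↦ ?_)
    · exact MeasurableSpace.measurableSet_generateFrom
        ⟨s, hs, Set.univ, MeasurableSet.univ, Set.inter_univ s⟩
    · exact MeasurableSpace.measurableSet_generateFrom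
        ⟨Set.univ, MeasurableSet.univ, s, hs, Set.univ_inter s⟩
  · refine MeasurableSpace.generateFrom_le ?_
    rintro _ ⟨s, hs, u, hu, rfl⟩
    have hs' : MeasurableSet[m₁ ⊔ m₂] s := (le_sup_left : m₁ ≤ m₁ ⊔ m₂) s hs
    have hu' : MeasurableSet[m₁ ⊔ m₂] u := (le_sup_right : m₂ ≤ m₁ ⊔ m₂) u hu
    exact hs'.inter hu'

lemma isPiSystem_image2_inter_measurableSet (m₁ m₂ : MeasurableSpace Ω) :
    IsPiSystem (Set.image2 (· ∩ ·) {s | MeasurableSet[m₁] s} {s | MeasurableSet[m₂] s}) := by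
  rintro _ ⟨s, hs, u, hu, rfl⟩ _ ⟨s', hs', u', hu', rfl⟩ _
  exact ⟨s ∩ s', MeasurableSet.inter hs hs', u ∩ u', MeasurableSet.inter hu hu',
    Set.inter_inter_inter_comm s s' u u'⟩

lemma norm_condExp_indicator_one_le (s : Set Ω) : ∀ᵐ ω ∂μ, ‖(μ⟦s | m⟧) ω‖ ≤ 1 := by
  refine ae_bdd_norm_condExp_of_ae_bdd_norm (R := 1) (ae_of_all μ fun ω ↦ ?_)
  by_cases h : ω ∈ s <;> simp [h]

variable [IsFiniteMeasure μ]

lemma integrable_indicator_one_of_measurableSet {s : Set Ω} (hs : MeasurableSet s) :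
    Integrable (s.indicator fun _ ↦ (1 : ℝ)) μ :=
  (integrable_const 1).indicator hs

/-- If `m₁` and `m` are conditionally independent given a sub-σ-algebra `m'` of `m`, then
conditioning a set of `m₁` on `m` is the same as conditioning it on `m'`. -/
lemma ProbabilityTheory.CondIndep.condExp_ae_eq_condExp [StandardBorelSpace Ω] {hm' : m' ≤ mΩ}
    (hm₁ : m₁ ≤ mΩ) (hm : m ≤ mΩ) (hmm : m' ≤ m) (h : CondIndep m' m₁ m hm' μ)
    {s : Set Ω} (hs : MeasurableSet[m₁] s) :
    μ⟦s | m'⟧ =ᵐ[μ] μ⟦s | m⟧ := by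
  refine ae_eq_condExp_of_forall_setIntegral_eq hm
    (integrable_indicator_one_of_measurableSet (hm₁ s hs))
    (fun _ _ _ ↦ integrable_condExp.integrableOn) (fun u hu _ ↦ ?_)
    (stronglyMeasurable_condExp.mono hmm).aestronglyMeasurable
  have h_pull := condExp_stronglyMeasurable_mul_of_bound hm'
    (stronglyMeasurable_condExp (m := m') (μ := μ) (f := s.indicator fun _ ↦ (1 : ℝ)))
    (integrable_indicator_one_of_measurableSet (μ := μ) (hm u hu)) 1
    (norm_condExp_indicator_one_le s)
  have h_mul := (condIndep_iff m' m₁ m hm' hm₁ hm μ).1 h s u hs hu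
  calc ∫ ω in u, (μ⟦s | m'⟧) ω ∂μ
    _ = ∫ ω, ((μ⟦s | m'⟧) * u.indicator fun _ ↦ (1 : ℝ)) ω ∂μ := by
      rw [← integral_indicator (hm u hu)]
      congr 1 with ω
      by_cases hω : ω ∈ u <;> simp [hω]
    _ = ∫ ω, (μ⟦s ∩ u | m'⟧) ω ∂μ := by
      rw [← integral_condExp hm']
      exact integral_congr_ae (h_pull.trans h_mul.symm)
    _ = ∫ ω in u, s.indicator (fun _ ↦ (1 : ℝ)) ω ∂μ := by
      rw [integral_condExp hm', ← integral_indicator (hm u hu), Set.indicator_indicator,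
        Set.inter_comm]

/-- **Contraction** for conditional independence: if `m₁` is conditionally independent of `m₂`
given `m`, and of `m` given a sub-σ-algebra `m'` of `m`, then it is conditionally independent of
`m₂ ⊔ m` given `m'`. -/
theorem ProbabilityTheory.CondIndep.sup_of_le [StandardBorelSpace Ω] {hm : m ≤ mΩ} {hm' : m' ≤ mΩ}
    (hm₁ : m₁ ≤ mΩ) (hm₂ : m₂ ≤ mΩ) (hmm : m' ≤ m)
    (h₂ : CondIndep m m₁ m₂ hm μ) (h : CondIndep m' m₁ m hm' μ) :
    CondIndep m' m₁ (m₂ ⊔ m) hm' μ := by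
  refine CondIndepSets.condIndep hm₁ (sup_le hm₂ hm)
    (@MeasurableSpace.isPiSystem_measurableSet Ω m₁)
    (isPiSystem_image2_inter_measurableSet m₂ m)
    (@MeasurableSpace.generateFrom_measurableSet Ω m₁).symm
    (sup_eq_generateFrom_image2_inter m₂ m) ?_
  rw [condIndepSets_iff m' hm' {s | MeasurableSet[m₁] s} _ (fun s hs ↦ hm₁ s hs)
    (by rintro _ ⟨s, hs, u, hu, rfl⟩; exact (hm₂ s hs).inter (hm u hu))]
  rintro s _ hs ⟨u, hu, w, hw, rfl⟩
  have hs_eq := h.condExp_ae_eq_condExp hm₁ hm hmm hs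
  have h_mul := (condIndep_iff m m₁ m₂ hm hm₁ hm₂ μ).1 h₂ s u hs hu
  have h_inter {r : Set Ω} (hr : MeasurableSet r) :
      μ⟦r ∩ w | m⟧ =ᵐ[μ] w.indicator (μ⟦r | m⟧) := by
    rw [Set.inter_comm, ← Set.indicator_indicator]
    exact condExp_indicator (integrable_indicator_one_of_measurableSet hr) hw
  have h_prod : μ⟦s ∩ (u ∩ w) | m⟧ =ᵐ[μ] (μ⟦s | m'⟧) * (μ⟦u ∩ w | m⟧) := by
    rw [← Set.inter_assoc]
    filter_upwards [h_inter ((hm₁ s hs).inter (hm₂ u hu)), h_inter (hm₂ u hu), h_mul, hs_eq]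
      with ω h1 h2 h3 h4
    rw [h1, Pi.mul_apply, h2, h4]
    by_cases hω : ω ∈ w <;> simp [hω, h3]
  calc μ⟦s ∩ (u ∩ w) | m'⟧
    _ =ᵐ[μ] μ[μ⟦s ∩ (u ∩ w) | m⟧ | m'] := (condExp_condExp_of_le hmm hm).symm
    _ =ᵐ[μ] μ[(μ⟦s | m'⟧) * (μ⟦u ∩ w | m⟧) | m'] := condExp_congr_ae h_prod
    _ =ᵐ[μ] (μ⟦s | m'⟧) * μ[μ⟦u ∩ w | m⟧ | m'] :=
      condExp_stronglyMeasurable_mul_of_bound hm' stronglyMeasurable_condExp integrable_condExp 1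
        (norm_condExp_indicator_one_le s)
    _ =ᵐ[μ] (μ⟦s | m'⟧) * (μ⟦u ∩ w | m'⟧) :=
      Filter.EventuallyEq.rfl.mul (condExp_condExp_of_le hmm hm)

end CondIndep

/-- **Strengthened independence of a Pt-score (Lemma 1).**
Let `t` be a `{0,1}`-valued treatment (modelled as `Bool`-valued), `y false, y true` the
potential outcomes, `v` a random variable, and for each arm `t'` let `P t'` be a measurable
function of `v`.  If `y t' ⫫ t | v` (exchangeability given `v`) and `y t' ⫫ v | P t' (v)`
(`P` is a Pt-score) hold for both arms, then `y t' ⫫ (t, v) | P t' (v)` for both arms. -/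
theorem ptScore_strengthened_independence
    {Ω : Type*} {mΩ : MeasurableSpace Ω} [StandardBorelSpace Ω]
    (μ : Measure Ω) [IsProbabilityMeasure μ]
    {V S Y : Type*} [MeasurableSpace V] [MeasurableSpace S] [MeasurableSpace Y]
    (t : Ω → Bool) (y : Bool → Ω → Y) (v : Ω → V) (P : Bool → V → S)
    (ht : Measurable t) (hy : ∀ t', Measurable (y t')) (hv : Measurable v)
    (hP : ∀ t', Measurable (P t'))
    (hexch : ∀ t', CondIndepFun (MeasurableSpace.comap v inferInstance) hv.comap_le
      (y t') t μ)
    (hscore : ∀ t', CondIndepFun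
      (MeasurableSpace.comap (fun ω => P t' (v ω)) inferInstance)
      (((hP t').comp hv).comap_le) (y t') v μ) :
    ∀ t', CondIndepFun
      (MeasurableSpace.comap (fun ω => P t' (v ω)) inferInstance)
      (((hP t').comp hv).comap_le) (y t') (fun ω => (t ω, v ω)) μ := by
  intro t'
  have hmm : MeasurableSpace.comap (fun ω => P t' (v ω)) inferInstance ≤
      MeasurableSpace.comap v inferInstance :=
    ((hP t').comp (comap_measurable v)).comap_le
  have h_exch := (condIndepFun_iff_condIndep _ _ _ _ _).1 (hexch t')
  have h_score := (condIndepFun_iff_condIndep _ _ _ _ _).1 (hscore t')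
  rw [condIndepFun_iff_condIndep]
  exact MeasurableSpace.comap_prodMk t v ▸
    h_exch.sup_of_le (hy t').comap_le ht.comap_le hmm h_score
end

section
/- Characterization of balancing scores (Rosenbaum–Rubin, Proposition in Appendix B.1): let t be a {0,1}-valued treatment, v a random variable on a standard Borel probability space, and β a measurable function of v. Then β(v) is a balancing score, i.e. t ⫫ v | β(v), if and only if the propensity score e(v) := P(t = 1 | v) is almost surely equal to a measurable function of β(v) (equivalently, e(v) is measurable with respect to the σ-algebra generated by β(v) up to null sets). -/
open MeasureTheory ProbabilityTheory

section CondExp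

variable {Ω : Type*} {m₁ m₂ mΩ : MeasurableSpace Ω} {μ : Measure Ω}

/-- If the conditional expectation of `f` given `m₂` is a.e. `m₁`-measurable for some `m₁ ≤ m₂`,
then it agrees with the conditional expectation of `f` given `m₁`. -/
theorem condExp_ae_eq_condExp_of_aestronglyMeasurable [IsFiniteMeasure μ]
    (h₁₂ : m₁ ≤ m₂) (h₂ : m₂ ≤ mΩ) {f : Ω → ℝ} (hf : AEStronglyMeasurable[m₁] (μ[f | m₂]) μ) :
    μ[f | m₂] =ᵐ[μ] μ[f | m₁] :=
  (condExp_of_aestronglyMeasurable' (h₁₂.trans h₂) hf integrable_condExp).symm.trans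
    (condExp_condExp_of_le h₁₂ h₂)

/-- The conditional probability of `s` given `m₂` reduces to the one given `m₁ ≤ m₂` if and only
if `s` is conditionally independent given `m₁` of every `m₂`-measurable set. -/
theorem condExp_indicator_ae_eq_iff_forall_inter_eq_mul [IsFiniteMeasure μ]
    (h₁₂ : m₁ ≤ m₂) (h₂ : m₂ ≤ mΩ) {s : Set Ω} (hs : MeasurableSet s) :
    μ⟦s | m₂⟧ =ᵐ[μ] μ⟦s | m₁⟧ ↔
      ∀ A, MeasurableSet[m₂] A → μ⟦s ∩ A | m₁⟧ =ᵐ[μ] μ⟦s | m₁⟧ * μ⟦A | m₁⟧ := by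
  have hint {B : Set Ω} (hB : MeasurableSet B) :
      Integrable (B.indicator fun _ ↦ (1 : ℝ)) μ := (integrable_const 1).indicator hB
  have hmul {A : Set Ω} :
      μ⟦s | m₁⟧ * (A.indicator fun _ ↦ (1 : ℝ)) = A.indicator (μ⟦s | m₁⟧) := by
    ext ω; by_cases h : ω ∈ A <;> simp [h]
  have hpull {A : Set Ω} (hA : MeasurableSet[m₂] A) :
      μ[A.indicator (μ⟦s | m₁⟧) | m₁] =ᵐ[μ] μ⟦s | m₁⟧ * μ⟦A | m₁⟧ := by
    rw [← hmul]
    refine condExp_mul_of_stronglyMeasurable_left stronglyMeasurable_condExp ?_ (hint (h₂ _ hA))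
    rw [hmul]
    exact integrable_condExp.indicator (h₂ _ hA)
  have hinter {A : Set Ω} : ((s ∩ A).indicator fun _ ↦ (1 : ℝ)) =
      A.indicator (s.indicator fun _ ↦ (1 : ℝ)) := by
    rw [Set.indicator_indicator, Set.inter_comm]
  constructor
  · intro h A hA
    calc μ⟦s ∩ A | m₁⟧
      _ =ᵐ[μ] μ[μ⟦s ∩ A | m₂⟧ | m₁] := (condExp_condExp_of_le h₁₂ h₂).symm
      _ =ᵐ[μ] μ[A.indicator (μ⟦s | m₂⟧) | m₁] := by
        rw [hinter]
        exact condExp_congr_ae (condExp_indicator (hint hs) hA)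
      _ =ᵐ[μ] μ[A.indicator (μ⟦s | m₁⟧) | m₁] :=
        condExp_congr_ae (h.mono fun ω hω ↦ by simp only [Set.indicator, hω])
      _ =ᵐ[μ] μ⟦s | m₁⟧ * μ⟦A | m₁⟧ := hpull hA
  · intro h
    refine (ae_eq_condExp_of_forall_setIntegral_eq h₂ (hint hs)
      (fun A _ _ ↦ integrable_condExp.integrableOn) (fun A hA _ ↦ ?_)
      (stronglyMeasurable_condExp.mono h₁₂).aestronglyMeasurable).symm
    rw [← integral_indicator (h₂ _ hA), ← integral_indicator (h₂ _ hA), ← hinter,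
      ← integral_condExp (h₁₂.trans h₂),
      ← integral_condExp (h₁₂.trans h₂) (f := (s ∩ A).indicator _)]
    exact integral_congr_ae ((hpull hA).trans (h A hA).symm)

/-- Two conditional probabilities agreeing on `{t = true}` agree on every event of the
`Bool`-valued variable `t`. -/
theorem condExp_indicator_preimage_bool_ae_eq [IsFiniteMeasure μ]
    (h₁ : m₁ ≤ mΩ) (h₂ : m₂ ≤ mΩ) {t : Ω → Bool} (ht : Measurable t)
    (h : μ⟦t ⁻¹' {true} | m₂⟧ =ᵐ[μ] μ⟦t ⁻¹' {true} | m₁⟧) (S : Set Bool) :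
    μ⟦t ⁻¹' S | m₂⟧ =ᵐ[μ] μ⟦t ⁻¹' S | m₁⟧ := by
  set T : Ω → ℝ := (t ⁻¹' {true}).indicator fun _ ↦ 1
  have hT : Integrable T μ := (integrable_const 1).indicator (ht (measurableSet_singleton _))
  set c : Bool → ℝ := S.indicator fun _ ↦ 1
  have hS : ((t ⁻¹' S).indicator fun _ ↦ (1 : ℝ)) =
      (fun _ ↦ c false) + (c true - c false) • T := by
    ext ω
    change c (t ω) = _
    cases hω : t ω <;> simp [T, hω]
  have hexp {m : MeasurableSpace Ω} (hm : m ≤ mΩ) :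
      μ⟦t ⁻¹' S | m⟧ =ᵐ[μ] (fun _ ↦ c false) + (c true - c false) • μ[T | m] := by
    rw [hS]
    refine (condExp_add (integrable_const _) (hT.smul _) m).trans ?_
    rw [condExp_const hm]
    exact (Filter.EventuallyEq.refl _ _).add (condExp_smul _ _ m)
  refine (hexp h₂).trans (Filter.EventuallyEq.trans ?_ (hexp h₁).symm)
  filter_upwards [h] with ω hω
  simp only [Pi.add_apply, Pi.smul_apply, hω]

end CondExp

/-- **Characterization of balancing scores (Rosenbaum–Rubin).**
Let `t` be a `{0,1}`-valued treatment (modelled as `Bool`-valued), `v` a random variable on a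
standard Borel probability space, and `β` a measurable function of `v`.  Then `β (v)` is a
balancing score, i.e. `t ⫫ v | β (v)`, if and only if the propensity score
`e(v) = P(t = 1 | v)` is almost surely equal to a measurable function of `β (v)`. -/
theorem balancing_score_characterization
    {Ω : Type*} {mΩ : MeasurableSpace Ω} [StandardBorelSpace Ω]
    (μ : Measure Ω) [IsProbabilityMeasure μ]
    {V B : Type*} [MeasurableSpace V] [MeasurableSpace B]
    (t : Ω → Bool) (v : Ω → V) (β : V → B)
    (ht : Measurable t) (hv : Measurable v) (hβ : Measurable β) :
    CondIndepFun (MeasurableSpace.comap (fun ω => β (v ω)) inferInstance)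
        ((hβ.comp hv).comap_le) t v μ
      ↔
    ∃ g : B → ℝ, Measurable g ∧
      (μ[(fun ω => if t ω = true then (1 : ℝ) else 0) |
          MeasurableSpace.comap v inferInstance])
        =ᵐ[μ] fun ω => g (β (v ω)) := by
  set m₁ : MeasurableSpace Ω := MeasurableSpace.comap (fun ω ↦ β (v ω)) inferInstance
  set m₂ : MeasurableSpace Ω := MeasurableSpace.comap v inferInstance
  have h₂ : m₂ ≤ mΩ := hv.comap_le
  have h₁₂ : m₁ ≤ m₂ := (hβ.comp (comap_measurable v)).comap_le
  have hT : (fun ω ↦ if t ω = true then (1 : ℝ) else 0) =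
      (t ⁻¹' {true}).indicator fun _ ↦ 1 := by
    ext ω; simp [Set.indicator]
  rw [hT, condIndepFun_iff _ _ _ _ ht hv]
  constructor
  · intro h
    have hs := ht (measurableSet_singleton true)
    obtain ⟨g, hg, hgeq⟩ := (stronglyMeasurable_condExp (m := m₁) (μ := μ)
      (f := (t ⁻¹' {true}).indicator fun _ ↦ (1 : ℝ))).measurable.exists_eq_measurable_comp
    refine ⟨g, hg, ?_⟩
    have := (condExp_indicator_ae_eq_iff_forall_inter_eq_mul (μ := μ) h₁₂ h₂ hs).2
      fun A hA ↦ h _ A ⟨_, measurableSet_singleton true, rfl⟩ hA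
    rwa [hgeq] at this
  · rintro ⟨g, hg, hge⟩ _ A ⟨S, hS, rfl⟩ hA
    have hmeas : StronglyMeasurable[m₁] fun ω ↦ g (β (v ω)) :=
      (hg.comp (comap_measurable fun ω ↦ β (v ω))).stronglyMeasurable
    exact (condExp_indicator_ae_eq_iff_forall_inter_eq_mul h₁₂ h₂ (ht hS)).1
      (condExp_indicator_preimage_bool_ae_eq (h₁₂.trans h₂) h₂ ht
        (condExp_ae_eq_condExp_of_aestronglyMeasurable h₁₂ h₂ ⟨_, hmeas, hge⟩) S) A hA
end

section
/- Balancing scores preserve weak ignorability (Proposition in Appendix B.1, second part): let t be a {0,1}-valued treatment, y(0), y(1) potential outcomes, and v a random variable on a standard Borel probability space giving weak ignorability: y(t') ⫫ t | v for t' = 0,1 and 0 < P(t = 1 | v) < 1 almost surely. If β(v) is a balancing score, i.e. t ⫫ v | β(v), then β(v) also gives weak ignorability: y(t') ⫫ t | β(v) for t' = 0,1 and 0 < P(t = 1 | β(v)) < 1 almost surely. -/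
open MeasureTheory ProbabilityTheory

section CondExp

variable {Ω : Type*} {m₁ m₂ mΩ : MeasurableSpace Ω} {μ : Measure Ω}

lemma ae_norm_condExp_indicator_one_le (m : MeasurableSpace Ω) (s : Set Ω) :
    ∀ᵐ ω ∂μ, ‖(μ⟦s | m⟧) ω‖ ≤ 1 := by
  simpa using ae_bdd_abs_condExp_of_ae_bdd_abs (m := m) (μ := μ) (R := 1)
    (f := s.indicator fun _ ↦ (1 : ℝ))
    (.of_forall fun ω ↦ by by_cases h : ω ∈ s <;> simp [h])

variable [IsProbabilityMeasure μ]

/-- If `s` is conditionally independent of `m₂` given `m₁ ≤ m₂`, then conditioning `s` on `m₂` is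
the same as conditioning it on `m₁`. -/
lemma condExp_indicator_ae_eq_of_forall_inter (h₁₂ : m₁ ≤ m₂) (h₂ : m₂ ≤ mΩ) {s : Set Ω}
    (hs : MeasurableSet s)
    (h : ∀ a, MeasurableSet[m₂] a →
      μ⟦s ∩ a | m₁⟧ =ᵐ[μ] fun ω ↦ (μ⟦s | m₁⟧) ω * (μ⟦a | m₁⟧) ω) :
    μ⟦s | m₂⟧ =ᵐ[μ] μ⟦s | m₁⟧ := by
  have h₁ : m₁ ≤ mΩ := h₁₂.trans h₂
  refine (ae_eq_condExp_of_forall_setIntegral_eq h₂ ((integrable_const 1).indicator hs)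
    (fun a _ _ ↦ integrable_condExp.integrableOn) (fun a ha _ ↦ ?_)
    (stronglyMeasurable_condExp.mono h₁₂).aestronglyMeasurable).symm
  have ha' : MeasurableSet a := h₂ a ha
  have hpull : μ[μ⟦s | m₁⟧ * a.indicator (fun _ ↦ (1 : ℝ)) | m₁] =ᵐ[μ] μ⟦s ∩ a | m₁⟧ :=
    (condExp_stronglyMeasurable_mul_of_bound h₁ stronglyMeasurable_condExp
      ((integrable_const 1).indicator ha') 1 (ae_norm_condExp_indicator_one_le m₁ s)).trans
      (h a ha).symm
  calc ∫ ω in a, (μ⟦s | m₁⟧) ω ∂μ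
      = ∫ ω, (μ⟦s | m₁⟧ * a.indicator (fun _ ↦ (1 : ℝ))) ω ∂μ := by
        rw [← integral_indicator ha']
        congr with ω
        by_cases hω : ω ∈ a <;> simp [hω]
    _ = ∫ ω, (μ⟦s ∩ a | m₁⟧) ω ∂μ := by
        rw [← integral_condExp h₁]
        exact integral_congr_ae hpull
    _ = ∫ ω in a, s.indicator (fun _ ↦ (1 : ℝ)) ω ∂μ := by
        rw [integral_condExp h₁, ← integral_indicator ha', Set.indicator_indicator, Set.inter_comm]

/-- Conditional independence of `r` and `s` given `m₂` descends to a smaller `m₁` for which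
conditioning `s` on `m₁` and on `m₂` agree. -/
lemma condExp_inter_ae_eq_mul_of_le (h₁₂ : m₁ ≤ m₂) (h₂ : m₂ ≤ mΩ) {r s : Set Ω}
    (h : μ⟦r ∩ s | m₂⟧ =ᵐ[μ] fun ω ↦ (μ⟦r | m₂⟧) ω * (μ⟦s | m₂⟧) ω)
    (hs : μ⟦s | m₂⟧ =ᵐ[μ] μ⟦s | m₁⟧) :
    μ⟦r ∩ s | m₁⟧ =ᵐ[μ] fun ω ↦ (μ⟦r | m₁⟧) ω * (μ⟦s | m₁⟧) ω := by
  have hmul : μ⟦r ∩ s | m₂⟧ =ᵐ[μ] μ⟦s | m₁⟧ * μ⟦r | m₂⟧ := by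
    filter_upwards [h, hs] with ω hω hsω
    rw [hω, hsω, Pi.mul_apply, mul_comm]
  have hpull : μ[μ⟦s | m₁⟧ * μ⟦r | m₂⟧ | m₁] =ᵐ[μ] μ⟦s | m₁⟧ * μ[μ⟦r | m₂⟧ | m₁] :=
    condExp_stronglyMeasurable_mul_of_bound (h₁₂.trans h₂) stronglyMeasurable_condExp
      integrable_condExp 1 (ae_norm_condExp_indicator_one_le m₁ s)
  filter_upwards [condExp_condExp_of_le (μ := μ) (f := (r ∩ s).indicator fun _ ↦ (1 : ℝ)) h₁₂ h₂,
    condExp_condExp_of_le (μ := μ) (f := r.indicator fun _ ↦ (1 : ℝ)) h₁₂ h₂,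
    condExp_congr_ae (m := m₁) hmul, hpull] with ω hrs hr hmulω hpullω
  rw [← hrs, hmulω, hpullω, Pi.mul_apply, hr, mul_comm]

end CondExp

/-- **Balancing scores preserve weak ignorability.**
Let `t` be a `{0,1}`-valued treatment (modelled as `Bool`-valued), `y false, y true` potential
outcomes, and `v` a random variable on a standard Borel probability space giving weak
ignorability: `y t' ⫫ t | v` for both arms and `0 < P(t = 1 | v) < 1` a.s.  If `β (v)` is a
balancing score, i.e. `t ⫫ v | β (v)`, then `β (v)` also gives weak ignorability:
`y t' ⫫ t | β (v)` for both arms and `0 < P(t = 1 | β (v)) < 1` a.s. -/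
theorem balancing_score_weak_ignorability
    {Ω : Type*} {mΩ : MeasurableSpace Ω} [StandardBorelSpace Ω]
    (μ : Measure Ω) [IsProbabilityMeasure μ]
    {V B Y : Type*} [MeasurableSpace V] [MeasurableSpace B] [MeasurableSpace Y]
    (t : Ω → Bool) (y : Bool → Ω → Y) (v : Ω → V) (β : V → B)
    (ht : Measurable t) (hy : ∀ t', Measurable (y t')) (hv : Measurable v)
    (hβ : Measurable β)
    -- weak ignorability given v
    (hexch : ∀ t', CondIndepFun (MeasurableSpace.comap v inferInstance)
      hv.comap_le (y t') t μ)
    (hpos : ∀ᵐ ω ∂μ,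
      0 < (μ[(fun ω' => if t ω' = true then (1 : ℝ) else 0) |
            MeasurableSpace.comap v inferInstance]) ω ∧
      (μ[(fun ω' => if t ω' = true then (1 : ℝ) else 0) |
            MeasurableSpace.comap v inferInstance]) ω < 1)
    -- β (v) is a balancing score
    (hbal : CondIndepFun (MeasurableSpace.comap (fun ω => β (v ω)) inferInstance)
      ((hβ.comp hv).comap_le) t v μ) :
    (∀ t', CondIndepFun (MeasurableSpace.comap (fun ω => β (v ω)) inferInstance)
      ((hβ.comp hv).comap_le) (y t') t μ) ∧
    (∀ᵐ ω ∂μ,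
      0 < (μ[(fun ω' => if t ω' = true then (1 : ℝ) else 0) |
            MeasurableSpace.comap (fun ω'' => β (v ω'')) inferInstance]) ω ∧
      (μ[(fun ω' => if t ω' = true then (1 : ℝ) else 0) |
            MeasurableSpace.comap (fun ω'' => β (v ω'')) inferInstance]) ω < 1) := by
  have hle : MeasurableSpace.comap (fun ω => β (v ω)) inferInstance ≤
      MeasurableSpace.comap v inferInstance := by
    rw [← Function.comp_def, ← MeasurableSpace.comap_comp]
    exact MeasurableSpace.comap_mono hβ.comap_le
  rw [condIndepFun_iff_condExp_inter_preimage_eq_mul ht hv] at hbal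
  have hT : ∀ s : Set Bool,
      μ⟦t ⁻¹' s | MeasurableSpace.comap v inferInstance⟧ =ᵐ[μ]
        μ⟦t ⁻¹' s | MeasurableSpace.comap (fun ω => β (v ω)) inferInstance⟧ := fun s ↦ by
    refine condExp_indicator_ae_eq_of_forall_inter hle hv.comap_le (ht (.of_discrete)) ?_
    rintro _ ⟨c, hc, rfl⟩
    exact hbal s c .of_discrete hc
  refine ⟨fun t' ↦ ?_, ?_⟩
  · have hex := hexch t'
    rw [condIndepFun_iff_condExp_inter_preimage_eq_mul (hy t') ht] at hex ⊢
    exact fun a s ha hs ↦ condExp_inter_ae_eq_mul_of_le hle hv.comap_le (hex a s ha hs) (hT s)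
  · have hind : (fun ω => if t ω = true then (1 : ℝ) else 0) =
        (t ⁻¹' {true}).indicator fun _ ↦ (1 : ℝ) := by
      ext ω
      by_cases h : t ω = true <;> simp [h]
    rw [hind] at hpos ⊢
    filter_upwards [hpos, hT {true}] with ω hω hTω
    rwa [← hTω]
end
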